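/- arXiv:1601.04566 — 2 statements merged into one kernel-verified Lean document; each statement's English description precedes it below -/
import Mathlib

section
/- Let V be an F₂-vector space of finite dimension k equipped with a quadratic form q : V → F₂, and let m ≥ 1 be an integer with k > 2m. Then the number of totally isotropic subspaces of V of dimension m is odd. -/
namespace Stmt5Aux

open Module

variable {V : Type*} [AddCommGroup V] [Module (ZMod 2) V] [FiniteDimensional (ZMod 2) V]

lemma z2 (a : ZMod 2) : a = 0 ∨ a = 1 := by
  revert a; decide

lemma add_self_V {V : Type*} [AddCommGroup V] [Module (ZMod 2) V] (x : V) : x + x = 0 := by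
  have h : ((1 : ZMod 2) + 1) • x = x + x := by rw [add_smul, one_smul]
  rw [← h, show ((1 : ZMod 2) + 1) = 0 by decide, zero_smul]

lemma finrank_inf_ker (W : Submodule (ZMod 2) V) (f : V →ₗ[ZMod 2] ZMod 2) :
    finrank (ZMod 2) W ≤ finrank (ZMod 2) (W ⊓ LinearMap.ker f : Submodule (ZMod 2) V) + 1 := by
  have h1 := Submodule.finrank_sup_add_finrank_inf_eq W (LinearMap.ker f)
  have h2 := LinearMap.finrank_range_add_finrank_ker f
  have h3 : finrank (ZMod 2) (LinearMap.range f) ≤ 1 := by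
    have := Submodule.finrank_le (LinearMap.range f)
    simpa using this
  have h4 := Submodule.finrank_le (W ⊔ LinearMap.ker f)
  omega

lemma exists_functional (x : V) (hx : x ≠ 0) : ∃ f : V →ₗ[ZMod 2] ZMod 2, f x = 1 := by
  obtain ⟨f, hf⟩ : ∃ f : Module.Dual (ZMod 2) V, f x ≠ 0 := by
    by_contra hc
    push Not at hc
    exact hx ((Module.forall_dual_apply_eq_zero_iff (ZMod 2) x).1 hc)
  exact ⟨f, (z2 _).resolve_left hf⟩

lemma exists_ne_zero (W : Submodule (ZMod 2) V) (h : 1 ≤ finrank (ZMod 2) W) :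
    ∃ u ∈ W, u ≠ 0 := by
  apply Submodule.exists_mem_ne_zero_of_ne_bot
  rintro rfl
  simp at h

lemma Q_add (Q : QuadraticForm (ZMod 2) V) (x y : V) :
    Q (x + y) = Q x + Q y + Q.polarBilin x y := by
  simp [QuadraticMap.polar]

open Classical in
lemma even_zeros [Fintype V] (Q : QuadraticForm (ZMod 2) V) (W : Submodule (ZMod 2) V)
    (h : 3 ≤ finrank (ZMod 2) W) :
    Even (Finset.univ.filter (fun x : V => x ∈ W ∧ Q x = 0)).card := by
  obtain ⟨u, huW, hu⟩ := exists_ne_zero W (by omega)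
  obtain ⟨f, hf⟩ := exists_functional u hu
  have h1 := finrank_inf_ker W f
  have h2 := finrank_inf_ker (W ⊓ LinearMap.ker f) (Q.polarBilin u)
  obtain ⟨v, ⟨⟨hvW, hvf⟩, hvu⟩, hv⟩ :=
    exists_ne_zero (W ⊓ LinearMap.ker f ⊓ LinearMap.ker (Q.polarBilin u)) (by omega)
  have hvf : f v = 0 := hvf
  have hvu : Q.polarBilin u v = 0 := hvu
  rw [← ZMod.natCast_eq_zero_iff_even]
  have e1 : ((Finset.univ.filter (fun x : V => x ∈ W ∧ Q x = 0)).card : ZMod 2)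
      = ∑ x ∈ Finset.univ.filter (fun x : V => x ∈ W), (1 + Q x) := by
    rw [Finset.card_eq_sum_ones, ← Finset.filter_filter, Finset.sum_filter]
    push_cast
    refine Finset.sum_congr rfl fun x _ => ?_
    rcases z2 (Q x) with h | h <;> simp [h] <;> decide
  have e2 : ∑ x ∈ Finset.univ.filter (fun x : V => x ∈ W), (1 + Q x)
      = ∑ x ∈ Finset.univ.filter (fun x : V => x ∈ W ∧ f x = 0), ((1 + Q x) + (1 + Q (x + u))) := by
    conv_rhs => rw [Finset.sum_add_distrib]
    rw [← Finset.sum_filter_add_sum_filter_not _ (fun x => f x = 0), Finset.filter_filter]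
    congr 1
    symm
    refine Finset.sum_bij' (fun x _ => x + u) (fun x _ => x + u) ?_ ?_ ?_ ?_ ?_
    · simp only [Finset.mem_filter, Finset.mem_univ, true_and, map_add, hf]
      rintro a ⟨ha, h0⟩
      exact ⟨W.add_mem ha huW, by rw [h0]; decide⟩
    · simp only [Finset.mem_filter, Finset.mem_univ, true_and, map_add, hf]
      rintro a ⟨ha, h0⟩
      exact ⟨W.add_mem ha huW, by rw [(z2 _).resolve_left h0]; decide⟩
    · intro a _; simp [add_assoc, add_self_V]
    · intro a _; simp [add_assoc, add_self_V]
    · intro a _; rfl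
  rw [e1, e2]
  refine Finset.sum_involution (fun x _ => x + v) ?_ ?_ ?_ ?_
  · intro a _
    have h3 : Q.polarBilin v u = 0 := by
      rw [← hvu]; simp [QuadraticMap.polar_comm]
    rw [Q_add Q (a + v) u, Q_add Q a u, map_add Q.polarBilin, LinearMap.add_apply, h3]
    generalize Q.polarBilin a u = p
    generalize Q (a + v) = p1
    generalize Q a = p2
    generalize Q u = p3
    revert p p1 p2 p3
    decide
  · intro a _ _ h
    exact hv (by simpa using h)
  · simp only [Finset.mem_filter, Finset.mem_univ, true_and, map_add, hvf]
    rintro a ⟨ha, h0⟩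
    exact ⟨W.add_mem ha hvW, by rw [h0]; decide⟩
  · intro a _; simp [add_assoc, add_self_V]

open Classical in
lemma odd_nonzero_zeros [Fintype V] (Q : QuadraticForm (ZMod 2) V) (W : Submodule (ZMod 2) V)
    (h : 3 ≤ finrank (ZMod 2) W) :
    Odd (Finset.univ.filter (fun x : V => x ∈ W ∧ Q x = 0 ∧ x ≠ 0)).card := by
  have h1 := even_zeros Q W h
  have h2 : Finset.univ.filter (fun x : V => x ∈ W ∧ Q x = 0 ∧ x ≠ 0)
      = (Finset.univ.filter (fun x : V => x ∈ W ∧ Q x = 0)).erase 0 := by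
    ext x; simp; tauto
  have h0 : (0 : V) ∈ Finset.univ.filter (fun x : V => x ∈ W ∧ Q x = 0) := by simp
  have h3 := Finset.card_erase_add_one h0
  rw [h2]
  rw [← h3] at h1
  by_contra hc
  rw [Nat.not_odd_iff_even] at hc
  exact (Nat.not_even_iff_odd.2 hc.add_one) h1

open Classical in
lemma odd_nonzero [Fintype V] (W : Submodule (ZMod 2) V)
    (h : 1 ≤ finrank (ZMod 2) W) :
    Odd (Finset.univ.filter (fun x : V => x ∈ W ∧ x ≠ 0)).card := by
  have h2 : Finset.univ.filter (fun x : V => x ∈ W ∧ x ≠ 0)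
      = (Finset.univ.filter (fun x : V => x ∈ W)).erase 0 := by
    ext x; simp; tauto
  have h0 : (0 : V) ∈ Finset.univ.filter (fun x : V => x ∈ W) := by simp
  have h3 := Finset.card_erase_add_one h0
  have h1 : Even (Finset.univ.filter (fun x : V => x ∈ W)).card := by
    have : (Finset.univ.filter (fun x : V => x ∈ W)).card = 2 ^ finrank (ZMod 2) W := by
      rw [← Fintype.card_subtype]
      have := Module.card_eq_pow_finrank (K := ZMod 2) (V := W)
      rw [ZMod.card] at this
      convert this
    rw [this]
    exact (even_two).pow_of_ne_zero (by omega)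
  rw [h2]
  rw [← h3] at h1
  by_contra hc
  rw [Nat.not_odd_iff_even] at hc
  exact (Nat.not_even_iff_odd.2 hc.add_one) h1

/-- subspaces -/
def P (Q : QuadraticForm (ZMod 2) V) (W : Submodule (ZMod 2) V) (m : ℕ)
    (E : Submodule (ZMod 2) V) : Prop :=
  E ≤ W ∧ finrank (ZMod 2) E = m ∧ ∀ x ∈ E, Q x = 0

lemma polar_zero (Q : QuadraticForm (ZMod 2) V) {E : Submodule (ZMod 2) V}
    (hE : ∀ x ∈ E, Q x = 0) {x y : V} (hx : x ∈ E) (hy : y ∈ E) : Q.polarBilin x y = 0 := by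
  have := Q_add Q x y
  rw [hE _ hx, hE _ hy, hE _ (E.add_mem hx hy)] at this
  simpa using this.symm

open Classical in
lemma card_link [Fintype V] [Fintype (Submodule (ZMod 2) V)]
    (Q : QuadraticForm (ZMod 2) V) (W : Submodule (ZMod 2) V) (m : ℕ)
    (x : V) (hx : x ∈ W) (hQ : Q x = 0) (f : V →ₗ[ZMod 2] ZMod 2) (hf : f x = 1) :
    (Finset.univ.filter (fun E => P Q W (m + 1) E ∧ x ∈ E)).card =
    (Finset.univ.filter (fun E => P Q (W ⊓ LinearMap.ker f ⊓ LinearMap.ker (Q.polarBilin x)) m E)).card := by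
  have hx0 : x ≠ 0 := by rintro rfl; simp at hf
  have hdis : (Submodule.span (ZMod 2) {x}) ⊓ LinearMap.ker f = ⊥ := by
    rw [eq_bot_iff]
    rintro y ⟨hy, hy2⟩
    obtain ⟨c, rfl⟩ := Submodule.mem_span_singleton.1 hy
    have : f (c • x) = 0 := hy2
    rw [map_smul, hf] at this
    have : c = 0 := by simpa using this
    simp [this]
  have hsp : finrank (ZMod 2) (Submodule.span (ZMod 2) {x}) = 1 := finrank_span_singleton hx0
  -- recover E
  have hrec : ∀ E : Submodule (ZMod 2) V, x ∈ E →
      E ⊓ LinearMap.ker f ⊔ Submodule.span (ZMod 2) {x} = E := by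
    intro E hxE
    apply le_antisymm
    · exact sup_le inf_le_left (by simpa using hxE)
    · intro y hy
      refine Submodule.mem_sup.2 ⟨y - f y • x, ⟨E.sub_mem hy (E.smul_mem _ hxE), ?_⟩, f y • x,
        Submodule.smul_mem _ _ (Submodule.mem_span_singleton_self x), by abel⟩
      simp [hf]
  have hrec2 : ∀ F : Submodule (ZMod 2) V, F ≤ LinearMap.ker f →
      (F ⊔ Submodule.span (ZMod 2) {x}) ⊓ LinearMap.ker f = F := by
    intro F hF
    rw [sup_inf_assoc_of_le _ hF, hdis, sup_bot_eq]
  have hfin : ∀ F : Submodule (ZMod 2) V, F ≤ LinearMap.ker f →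
      finrank (ZMod 2) (F ⊔ Submodule.span (ZMod 2) {x} : Submodule (ZMod 2) V)
        = finrank (ZMod 2) F + 1 := by
    intro F hF
    have h := Submodule.finrank_sup_add_finrank_inf_eq F (Submodule.span (ZMod 2) {x})
    have h0 : F ⊓ Submodule.span (ZMod 2) {x} = ⊥ := by
      rw [eq_bot_iff, ← hdis]
      exact le_inf inf_le_right (inf_le_left.trans hF)
    rw [h0, hsp] at h
    simpa using h
  refine Finset.card_bij' (fun E _ => E ⊓ LinearMap.ker f)
    (fun F _ => F ⊔ Submodule.span (ZMod 2) {x}) ?_ ?_ ?_ ?_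
  · simp only [Finset.mem_filter, Finset.mem_univ, true_and]
    rintro E ⟨⟨hEW, hEm, hEQ⟩, hxE⟩
    refine ⟨?_, ?_, fun y hy => hEQ y hy.1⟩
    · rintro y ⟨hy, hyf⟩
      exact ⟨⟨hEW hy, hyf⟩, polar_zero Q hEQ hxE hy⟩
    · have := hfin (E ⊓ LinearMap.ker f) inf_le_right
      rw [hrec E hxE] at this
      omega
  · simp only [Finset.mem_filter, Finset.mem_univ, true_and]
    rintro F ⟨hFW, hFm, hFQ⟩
    have hFf : F ≤ LinearMap.ker f := hFW.trans (inf_le_left.trans inf_le_right)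
    refine ⟨⟨sup_le (hFW.trans (inf_le_left.trans inf_le_left)) (by simpa using hx), ?_, ?_⟩, ?_⟩
    · rw [hfin F hFf, hFm]
    · intro y hy
      obtain ⟨a, ha, b, hb, rfl⟩ := Submodule.mem_sup.1 hy
      obtain ⟨c, rfl⟩ := Submodule.mem_span_singleton.1 hb
      have hp : Q.polarBilin x a = 0 := (hFW ha).2
      rw [add_comm, Q_add, map_smul Q.polarBilin, LinearMap.smul_apply, hp, hFQ a ha, QuadraticMap.map_smul, hQ]
      simp
    · exact Submodule.mem_sup_right (Submodule.mem_span_singleton_self x)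
  · simp only [Finset.mem_filter, Finset.mem_univ, true_and]
    rintro E ⟨_, hxE⟩
    exact hrec E hxE
  · simp only [Finset.mem_filter, Finset.mem_univ, true_and]
    rintro F ⟨hFW, _⟩
    exact hrec2 F (hFW.trans (inf_le_left.trans inf_le_right))

open Classical in
lemma main [Fintype V] [Fintype (Submodule (ZMod 2) V)]
    (Q : QuadraticForm (ZMod 2) V) (m : ℕ) : ∀ (W : Submodule (ZMod 2) V),
    2 * m < finrank (ZMod 2) W →
    Odd (Finset.univ.filter (fun E => P Q W m E)).card := by
  induction m with
  | zero =>
    intro W _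
    have : Finset.univ.filter (fun E => P Q W 0 E) = {⊥} := by
      ext E
      simp only [Finset.mem_filter, Finset.mem_univ, true_and, Finset.mem_singleton]
      constructor
      · rintro ⟨_, h, _⟩
        exact Submodule.finrank_eq_zero.1 h
      · rintro rfl
        simp [P]
    rw [this]; simp
  | succ m ih =>
    intro W hW
    have hdc := Finset.sum_card_bipartiteAbove_eq_sum_card_bipartiteBelow
      (s := Finset.univ.filter (fun x : V => x ∈ W ∧ Q x = 0 ∧ x ≠ 0))
      (t := Finset.univ.filter (fun E => P Q W (m + 1) E)) (fun x E => x ∈ E)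
    have hz := odd_nonzero_zeros Q W (by omega)
    rw [← ZMod.natCast_eq_one_iff_odd] at hz ⊢
    have hdc2 := congrArg (Nat.cast : ℕ → ZMod 2) hdc
    push_cast at hdc2
    rw [Finset.sum_congr rfl (g := fun _ => (1 : ZMod 2)) ?_,
      Finset.sum_congr (s₁ := Finset.univ.filter (fun E => P Q W (m + 1) E)) rfl
        (g := fun _ => (1 : ZMod 2)) ?_] at hdc2
    · simp only [Finset.sum_const, nsmul_eq_mul, mul_one] at hdc2
      rw [← hdc2, hz]
    · intro E hE
      simp only [Finset.mem_filter, Finset.mem_univ, true_and] at hE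
      obtain ⟨hEW, hEm, hEQ⟩ := hE
      rw [ZMod.natCast_eq_one_iff_odd]
      convert odd_nonzero E (by omega) using 2
      ext y
      simp only [Finset.bipartiteBelow, Finset.mem_filter, Finset.mem_univ, true_and]
      constructor
      · rintro ⟨⟨_, _, h⟩, h'⟩; exact ⟨h', h⟩
      · rintro ⟨h', h⟩; exact ⟨⟨hEW h', hEQ y h', h⟩, h'⟩
    · intro x hx
      simp only [Finset.mem_filter, Finset.mem_univ, true_and] at hx
      obtain ⟨hxW, hxQ, hx0⟩ := hx
      obtain ⟨f, hf⟩ := exists_functional x hx0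
      rw [ZMod.natCast_eq_one_iff_odd, Finset.bipartiteAbove, Finset.filter_filter,
        card_link Q W m x hxW hxQ f hf]
      apply ih
      have h1 := finrank_inf_ker W f
      have h2 := finrank_inf_ker (W ⊓ LinearMap.ker f) (Q.polarBilin x)
      omega

end Stmt5Aux

/-- Let `V` be an `F₂`-vector space of finite dimension `k` with a quadratic form `Q`, and let
`m ≥ 1` satisfy `k > 2m`.  Then the number of totally isotropic subspaces of `V` of
dimension `m` is odd. -/
theorem stmt_5 (V : Type*) [AddCommGroup V] [Module (ZMod 2) V]
    [FiniteDimensional (ZMod 2) V] (Q : QuadraticForm (ZMod 2) V)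
    (k m : ℕ) (hk : Module.finrank (ZMod 2) V = k) (hm : 1 ≤ m) (hkm : 2 * m < k) :
    Odd (Nat.card {E : Submodule (ZMod 2) V //
      Module.finrank (ZMod 2) E = m ∧ ∀ x ∈ E, Q x = 0}) := by
  classical
  haveI : Finite V := Module.finite_of_finite (ZMod 2)
  haveI : Fintype V := Fintype.ofFinite V
  haveI : Fintype (Submodule (ZMod 2) V) := Fintype.ofFinite _
  have h := Stmt5Aux.main Q m ⊤ (by rw [finrank_top]; omega)
  rw [Nat.card_eq_fintype_card, Fintype.card_subtype]
  convert h using 3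
  simp [Stmt5Aux.P]
end

section
/- Let G be a finite group with normal Sylow p-subgroup S and C_G(S) ≤ S. Suppose 1 = S₀ < S₁ < ⋯ < S_k = S are normal subgroups of G such that: (i) S_{k-1} ≤ Φ(S); and (ii) for each 1 ≤ i ≤ k-1, S_i is characteristic in G, [S, S_i] ≤ S_{i-1}, S_i/S_{i-1} has exponent p, and Hom_{F_p[G/S]}(S/Φ(S), S_i/S_{i-1}) = 0. If α ∈ Aut(G) satisfies [α, S] ≤ S_{k-1} (i.e., α(x)x⁻¹ ∈ S_{k-1} for all x ∈ S), then α is conjugation by an element of S. -/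
theorem aux_avg {G Q : Type*} [Group G] [Finite G] [Group Q] (S : Subgroup G) (A : Subgroup Q)
    (hAn : A.Normal) (hAc : ∀ a ∈ A, ∀ b ∈ A, a * b = b * a) (γ π : G →* Q)
    (hA : ∀ g, γ g * (π g)⁻¹ ∈ A) (hS : ∀ x ∈ S, γ x = π x)
    (hcop : (Nat.card A).Coprime S.index) :
    ∃ t ∈ A, ∀ g, t⁻¹ * γ g * t = π g := by
  classical
  let _ : CommGroup A := { (inferInstance : Group A) with
    mul_comm := fun a b => Subtype.ext (hAc a a.2 b b.2) }
  have : Fintype (G ⧸ S) := Fintype.ofFinite _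
  let c : G → A := fun g => ⟨γ g * (π g)⁻¹, hA g⟩
  have hc : ∀ a b : G, (QuotientGroup.leftRel S) a b → c a = c b := by
    intro a b h
    rw [QuotientGroup.leftRel_apply] at h
    have h2 := hS _ h
    apply Subtype.ext
    change γ a * (π a)⁻¹ = γ b * (π b)⁻¹
    have hb : b = a * (a⁻¹ * b) := by group
    rw [hb, map_mul γ a, map_mul π a, h2]
    group
  let cq : G ⧸ S → A := fun r => Quotient.liftOn' r c hc
  let cj : G → A →* A := fun g =>
    { toFun := fun a => ⟨π g * a * (π g)⁻¹, hAn.conj_mem _ a.2 _⟩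
      map_one' := by apply Subtype.ext; simp
      map_mul' := by intro a b; apply Subtype.ext; simp }
  have hcq : ∀ (g : G) (r : G ⧸ S), cq (g • r) = c g * cj g (cq r) := by
    intro g r
    induction r using QuotientGroup.induction_on with
    | H x =>
      apply Subtype.ext
      change γ (g * x) * (π (g * x))⁻¹ = γ g * (π g)⁻¹ * (π g * (γ x * (π x)⁻¹) * (π g)⁻¹)
      simp only [map_mul]; group
  let u : A := ∏ r, cq r
  have hu : ∀ g, u = c g ^ S.index * cj g u := by
    intro g
    calc u = ∏ r, cq (g • r) := (Equiv.prod_comp (MulAction.toPerm g : Equiv.Perm (G ⧸ S)) cq).symm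
      _ = ∏ r, (c g * cj g (cq r)) := Finset.prod_congr rfl (fun r _ => hcq g r)
      _ = _ := by
        rw [Finset.prod_mul_distrib, Finset.prod_const, map_prod, Finset.card_univ,
          ← Nat.card_eq_fintype_card]; rfl
  obtain ⟨t, ht⟩ := (powCoprime hcop).surjective u
  have ht' : t ^ S.index = u := ht
  refine ⟨t, t.2, fun g => ?_⟩
  have h1 : t = c g * cj g t := by
    apply (powCoprime hcop).injective
    change t ^ S.index = (c g * cj g t) ^ S.index
    rw [mul_pow, ← map_pow, ht']; exact hu g
  have h2 : (t : Q) = γ g * (π g)⁻¹ * (π g * t * (π g)⁻¹) := congrArg Subtype.val h1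
  have h3 : (t : Q) * π g = γ g * t := by
    conv_lhs => rw [h2]
    group
  rw [mul_assoc, ← h3]; group

theorem aux_dual (p : ℕ) [Fact p.Prime] {A : Type*} [AddCommGroup A] [Module (ZMod p) A]
    (a : A) (ha : a ≠ 0) : ∃ φ : A →+ ZMod p, φ a ≠ 0 := by
  by_contra! h
  exact ha ((Module.forall_dual_apply_eq_zero_iff (ZMod p) a).1 (fun φ => h φ.toAddMonoidHom))

theorem aux_frat_comm {p : ℕ} [Fact p.Prime] {P E : Type*} [Group P] [CommGroup E]
    (hE : ∀ e : E, e ^ p = 1) (f : P →* E)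
    (x : P) (hx : x ∈ frattini P) : f x = 1 := by
  let _ : Module (ZMod p) (Additive E) := AddCommGroup.zmodModule (fun e => hE e.toMul)
  by_contra hne
  have : ∃ φ : Additive E →+ ZMod p, φ (Additive.ofMul (f x)) ≠ 0 :=
    aux_dual p (Additive.ofMul (f x)) (fun h => hne (Additive.ofMul.injective h))
  obtain ⟨φ, hφ⟩ := this
  let ψ : P →* Multiplicative (ZMod p) :=
    (AddMonoidHom.toMultiplicative φ).comp
      ((MulEquiv.toMultiplicative_toAdditive (G := E)).toMonoidHom.comp f)
  have hψ : ψ x ≠ 1 := fun h => hφ h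
  have hidx : ψ.ker.index = p := by
    have h1 : ψ.ker.index = Nat.card ψ.range := Subgroup.index_ker ψ
    have h2 : Nat.card ψ.range ∣ p := by
      have := Subgroup.card_subgroup_dvd_card ψ.range
      simpa using this
    rcases (Nat.dvd_prime (Fact.out : p.Prime)).1 h2 with h | h
    · exfalso
      rw [← h1, Subgroup.index_eq_one] at h
      exact hψ (by rw [← MonoidHom.mem_ker, h]; trivial)
    · rw [h1, h]
  have hco : IsCoatom ψ.ker := by
    constructor
    · intro h; rw [h, Subgroup.index_top] at hidx
      exact (Fact.out : p.Prime).one_lt.ne hidx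
    · intro K hK
      have h := Subgroup.relIndex_mul_index hK.le
      rw [hidx] at h
      rcases (Nat.dvd_prime (Fact.out : p.Prime)).1 (Dvd.intro_left _ h) with h' | h'
      · exact Subgroup.index_eq_one.1 h'
      · exfalso
        rw [h'] at h
        have : ψ.ker.relIndex K = 1 :=
          Nat.eq_of_mul_eq_mul_right (Fact.out : p.Prime).pos (by simpa using h)
        exact hK.not_ge (Subgroup.relIndex_eq_one.1 this)
  exact hψ (frattini_le_coatom hco hx)

theorem aux_frat {p : ℕ} [Fact p.Prime] {P E : Type*} [Group P] [Group E]
    (hc : ∀ a b : E, a * b = b * a) (hE : ∀ e : E, e ^ p = 1) (f : P →* E)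
    (x : P) (hx : x ∈ frattini P) : f x = 1 := by
  let _ : CommGroup E := { (inferInstance : Group E) with mul_comm := hc }
  exact aux_frat_comm hE f x hx

theorem aux_burnside {p : ℕ} [Fact p.Prime] {G : Type*} [Group G] [Finite G]
    (P : Sylow p G) (hPn : (P : Subgroup G).Normal)
    (hcent : Subgroup.centralizer ((P : Subgroup G) : Set G) ≤ (P : Subgroup G))
    (N : Subgroup G) (hN : N.Normal)
    (hfrat : N ≤ (frattini ↥(P : Subgroup G)).map (P : Subgroup G).subtype)
    (d : G) (hd : ∀ x ∈ (P : Subgroup G), d * x * d⁻¹ * x⁻¹ ∈ N) : d ∈ (P : Subgroup G) := by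
  classical
  have hNP : N ≤ (P : Subgroup G) := hfrat.trans (Subgroup.map_subtype_le _)
  have hpow : ∀ n : ℕ, ∀ x ∈ (P : Subgroup G), d ^ n * x * (d ^ n)⁻¹ * x⁻¹ ∈ N := by
    intro n
    induction n with
    | zero => intro x _; simp
    | succ n ih =>
      intro x hx
      have h1 := hd _ (hPn.conj_mem x hx (d ^ n))
      have h2 := N.mul_mem h1 (ih x hx)
      convert h2 using 1
      rw [pow_succ']; group
  have key : ∀ q : ℕ, q.Prime → q ∣ orderOf d → q = p := by
    intro q hq hqd
    by_contra hqp
    have : Fact q.Prime := ⟨hq⟩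
    obtain ⟨m, hm⟩ := hqd
    have hm0 : m ≠ 0 := by
      rintro rfl; exact (orderOf_pos d).ne' (by simpa using hm)
    have hoe : orderOf (d ^ m) = q := by
      rw [orderOf_pow_of_dvd hm0 (by rw [hm]; exact dvd_mul_left _ _), hm,
        Nat.mul_div_cancel _ (Nat.pos_of_ne_zero hm0)]
    have he := hpow m
    generalize d ^ m = e at hoe he
    have hec : e ∈ Subgroup.centralizer ((P : Subgroup G) : Set G) := by
      let C : Subgroup (P : Subgroup G) := (Subgroup.centralizer {e}).subgroupOf P
      have hC : C = ⊤ := by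
        apply frattini_nongenerating
        rw [eq_top_iff]
        rintro ⟨x, hx⟩ -
        have hiff : ∀ y : G, x⁻¹ * y ∈ N → x⁻¹ * (e * y * e⁻¹) ∈ N := by
          intro y hy
          have hyP : y ∈ (P : Subgroup G) := by
            have := mul_mem hx (hNP hy); simpa using this
          have h1 := N.mul_mem hy (hN.conj_mem _ (he y hyP) y⁻¹)
          convert h1 using 1
          group
        have hmap : Set.MapsTo (MulAut.conj e) {y | x⁻¹ * y ∈ N} {y | x⁻¹ * y ∈ N} := hiff
        have hinj : ∀ y : G, x⁻¹ * (MulAut.conj e).toEquiv y ∈ N ↔ x⁻¹ * y ∈ N := by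
          intro y
          refine ⟨fun h => ?_, hiff y⟩
          have hit : ∀ n : ℕ, x⁻¹ * (e ^ n * (e * y * e⁻¹) * (e ^ n)⁻¹) ∈ N := by
            intro n
            induction n with
            | zero => simpa using h
            | succ n ih =>
              have := hiff _ ih
              convert this using 2
              rw [pow_succ']; group
          have h1 := hit (q - 1)
          have h2 : e ^ (q - 1) * e = 1 := by
            rw [← pow_succ, Nat.sub_add_cancel hq.one_le, ← hoe, pow_orderOf_eq_one]
          have h3 : e ^ (q - 1) = e⁻¹ := eq_inv_of_mul_eq_one_left h2
          rw [h3] at h1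
          convert h1 using 2
          group
        let σ : Equiv.Perm {y // x⁻¹ * y ∈ N} :=
          Equiv.Perm.subtypePerm (MulAut.conj e).toEquiv hinj
        have : Fintype {y // x⁻¹ * y ∈ N} := Fintype.ofFinite _
        have hcard : ¬ q ∣ Fintype.card {y // x⁻¹ * y ∈ N} := by
          have hcN : Fintype.card {y // x⁻¹ * y ∈ N} = Nat.card N := by
            rw [← Nat.card_eq_fintype_card]
            exact Nat.card_congr ((Equiv.mulLeft x⁻¹).subtypeEquiv (fun a => Iff.rfl))
          rw [hcN]
          obtain ⟨n, hn⟩ := (IsPGroup.iff_card).1 (P.2.to_le hNP)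
          rw [hn]
          intro h
          exact hqp ((Nat.prime_dvd_prime_iff_eq hq Fact.out).1 (hq.dvd_of_dvd_pow h))
        have hσ : σ ^ q ^ 1 = 1 := by
          have hit : ∀ n : ℕ, ∀ y, ((σ ^ n) y : G) = e ^ n * y * (e ^ n)⁻¹ := by
            intro n
            induction n with
            | zero => intro y; simp
            | succ n ih =>
              intro y
              rw [pow_succ', Equiv.Perm.mul_apply]
              change e * ((σ ^ n) y : G) * e⁻¹ = _
              rw [ih, pow_succ']; group
          ext y
          rw [hit, pow_one, ← hoe, pow_orderOf_eq_one]; simp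
        obtain ⟨⟨y, hy⟩, hfix⟩ := Equiv.Perm.exists_fixed_point_of_prime hcard hσ
        have hfix' : e * y * e⁻¹ = y := congrArg Subtype.val hfix
        have hyP : y ∈ (P : Subgroup G) := by
          have := mul_mem hx (hNP hy); simpa using this
        obtain ⟨z, hz, hzy⟩ := hfrat hy
        have hxe : (⟨x, hx⟩ : (P : Subgroup G)) = ⟨y, hyP⟩ * z⁻¹ := by
          apply Subtype.ext
          change x = y * (z : G)⁻¹
          have : (z : G) = x⁻¹ * y := hzy
          rw [this]; group
        rw [hxe]
        refine Subgroup.mul_mem_sup ?_ (inv_mem hz)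
        rw [Subgroup.mem_subgroupOf, Subgroup.mem_centralizer_singleton_iff]
        have := mul_inv_eq_iff_eq_mul.1 hfix'
        first | exact this | exact this.symm
      intro x hx
      have : (⟨x, hx⟩ : (P : Subgroup G)) ∈ C := by rw [hC]; trivial
      rw [Subgroup.mem_subgroupOf, Subgroup.mem_centralizer_singleton_iff] at this
      first | exact this | exact this.symm
    have heP := hcent hec
    obtain ⟨n, hn⟩ := (IsPGroup.iff_orderOf).1 P.2 ⟨e, heP⟩
    rw [Subgroup.orderOf_mk, hoe] at hn
    exact hqp ((Nat.prime_dvd_prime_iff_eq hq Fact.out).1 (hq.dvd_of_dvd_pow (dvd_of_eq hn)))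
  have hord := Nat.eq_prime_pow_of_unique_prime_dvd (orderOf_pos d).ne' (fun {q} h1 h2 => key q h1 h2)
  have hpg : IsPGroup p (Subgroup.zpowers d) := by
    apply IsPGroup.of_card (n := (orderOf d).primeFactorsList.length)
    rw [Nat.card_zpowers]; exact hord
  obtain ⟨Q, hQ⟩ := hpg.exists_le_sylow
  have hu := Sylow.unique_of_normal P hPn
  have : Q = P := Subsingleton.elim _ _
  rw [this] at hQ
  exact hQ (Subgroup.mem_zpowers d)

theorem aux_step {p : ℕ} [Fact p.Prime] {G : Type*} [Group G] [Finite G]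
    (P : Sylow p G) (hPn : (P : Subgroup G).Normal) (K N : Subgroup G) (hK : K.Normal)
    (hN : N.Normal) (hKP : K ≤ P)
    (hKc : ∀ a ∈ K, ∀ b ∈ K, a * b * a⁻¹ * b⁻¹ ∈ N) (α : MulAut G)
    (h1 : ∀ g, α g * g⁻¹ ∈ K) (h2 : ∀ x ∈ (P : Subgroup G), α x * x⁻¹ ∈ N) :
    ∃ t ∈ K, ∀ g, t * α g * t⁻¹ * g⁻¹ ∈ N := by
  have hmk : ∀ a b : G, (QuotientGroup.mk' N a = QuotientGroup.mk' N b) ↔ a * b⁻¹ ∈ N := by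
    intro a b
    rw [← mul_inv_eq_one, ← map_inv, ← map_mul, ← MonoidHom.mem_ker, QuotientGroup.ker_mk']
  have hcop : (Nat.card (K.map (QuotientGroup.mk' N))).Coprime (P : Subgroup G).index := by
    have hp : IsPGroup p (K.map (QuotientGroup.mk' N)) := (P.2.to_le hKP).map _
    obtain ⟨n, hn⟩ := IsPGroup.iff_card.1 hp
    rw [hn]
    exact Nat.Coprime.pow_left _ ((Nat.Prime.coprime_iff_not_dvd Fact.out).2 P.not_dvd_index)
  obtain ⟨t, ⟨k, hk, rfl⟩, ht⟩ := aux_avg (P : Subgroup G) (K.map (QuotientGroup.mk' N))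
    (hK.map _ (QuotientGroup.mk'_surjective N))
    (by
      rintro _ ⟨a, ha, rfl⟩ _ ⟨b, hb, rfl⟩
      rw [← map_mul, ← map_mul, hmk]
      have := hKc a ha b hb
      convert this using 1; group)
    ((QuotientGroup.mk' N).comp α.toMonoidHom) (QuotientGroup.mk' N)
    (by intro g; exact ⟨_, h1 g, by simp⟩)
    (by intro x hx; exact (hmk _ _).2 (h2 x hx)) hcop
  refine ⟨k⁻¹, inv_mem hk, fun g => ?_⟩
  rw [← hmk, ← ht g]
  simp

/-- Let `G` be a finite group with a normal Sylow `p`-subgroup `S` such that `C_G(S) ≤ S`,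
and let `1 = S₀ < S₁ < ⋯ < S_k = S` be normal subgroups of `G` such that
`S_{k-1} ≤ Φ(S)` and, for `1 ≤ i ≤ k-1`: `S_i` is characteristic in `G`,
`[S, S_i] ≤ S_{i-1}`, `S_i/S_{i-1}` has exponent `p`, and
`Hom_{F_p[G/S]}(S/Φ(S), S_i/S_{i-1}) = 0`.  Then any `α ∈ Aut(G)` with `[α, S] ≤ S_{k-1}`
is conjugation by an element of `S`. -/
theorem stmt_9 (p : ℕ) [Fact p.Prime] (G : Type*) [Group G] [Finite G]
    (P : Sylow p G) (hPn : (P : Subgroup G).Normal)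
    (hcent : Subgroup.centralizer ((P : Subgroup G) : Set G) ≤ (P : Subgroup G))
    (k : ℕ) (hk : 1 ≤ k) (S : ℕ → Subgroup G)
    (hS0 : S 0 = ⊥) (hSk : S k = (P : Subgroup G))
    (hmono : ∀ i, i < k → S i < S (i + 1))
    (hnorm : ∀ i, i ≤ k → (S i).Normal)
    -- (i) `S_{k-1} ≤ Φ(S)`:
    (hfrat : S (k - 1) ≤ (frattini ↥(P : Subgroup G)).map (P : Subgroup G).subtype)
    -- (iii) for each `1 ≤ i ≤ k-1`:
    (hchar : ∀ i, 1 ≤ i → i ≤ k - 1 → (S i).Characteristic)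
    (hcomm : ∀ i, 1 ≤ i → i ≤ k - 1 → ⁅(P : Subgroup G), S i⁆ ≤ S (i - 1))
    (hexp : ∀ i, 1 ≤ i → i ≤ k - 1 → ∀ x ∈ S i, x ^ p ∈ S (i - 1))
    -- `Hom_{F_p[G/S]}(S/Φ(S), S_i/S_{i-1}) = 0`: every homomorphism from `S` to
    -- `S_i/S_{i-1}` vanishing on `Φ(S)` and equivariant for the conjugation action
    -- of `G` is trivial:
    (hhom : ∀ i, (hi1 : 1 ≤ i) → (hi2 : i ≤ k - 1) →
      letI : ((S (i - 1)).subgroupOf (S i)).Normal :=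
        Subgroup.Normal.subgroupOf (hnorm (i - 1) (by omega)) (S i)
      ∀ f : ↥(P : Subgroup G) →* (↥(S i) ⧸ (S (i - 1)).subgroupOf (S i)),
        (∀ x : ↥(P : Subgroup G), x ∈ frattini ↥(P : Subgroup G) → f x = 1) →
        (∀ (g : G) (x : ↥(P : Subgroup G)) (y : ↥(S i)),
          f x = QuotientGroup.mk y →
          f ⟨g * (x : G) * g⁻¹, hPn.conj_mem _ x.2 g⟩ =
            QuotientGroup.mk
              (⟨g * (y : G) * g⁻¹, (hnorm i (by omega)).conj_mem _ y.2 g⟩ : ↥(S i))) →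
        f = 1)
    (α : MulAut G) (hα : ∀ x ∈ (P : Subgroup G), α x * x⁻¹ ∈ S (k - 1)) :
    ∃ s ∈ (P : Subgroup G), α = MulAut.conj s := by
  have hle : ∀ j i, i ≤ j → j ≤ k → S i ≤ S j := by
    intro j i hij
    induction j, hij using Nat.le_induction with
    | base => intro _; exact le_rfl
    | succ n hn ih => intro h; exact (ih (by omega)).trans (hmono n (by omega)).le
  have hSP : ∀ i, i ≤ k → S i ≤ (P : Subgroup G) := fun i hi => hSk ▸ hle k i hi le_rfl
  have main : ∀ j, j ≤ k - 1 → ∃ s ∈ (P : Subgroup G),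
      ∀ g, s * α g * s⁻¹ * g⁻¹ ∈ S (k - 1 - j) := by
    intro j
    induction j with
    | zero =>
      intro _
      have hNn := hnorm (k - 1) (by omega)
      let K : Subgroup G :=
        { carrier := {d | d ∈ (P : Subgroup G) ∧ ∀ x ∈ (P : Subgroup G), d * x * d⁻¹ * x⁻¹ ∈ S (k - 1)}
          one_mem' := ⟨one_mem _, by intro x _; simp⟩
          mul_mem' := by
            rintro a b ⟨ha, ha'⟩ ⟨hb, hb'⟩
            refine ⟨mul_mem ha hb, fun x hx => ?_⟩
            have := mul_mem (ha' _ (hPn.conj_mem x hx b)) (hb' x hx)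
            convert this using 1; group
          inv_mem' := by
            rintro a ⟨ha, ha'⟩
            refine ⟨inv_mem ha, fun x hx => ?_⟩
            have := inv_mem (ha' _ (hPn.conj_mem x hx a⁻¹))
            convert this using 1; group }
      have hKn : K.Normal := by
        constructor
        rintro a ⟨ha, ha'⟩ g
        refine ⟨hPn.conj_mem a ha g, fun x hx => ?_⟩
        have := hNn.conj_mem _ (ha' _ (hPn.conj_mem x hx g⁻¹)) g
        convert this using 1; group
      obtain ⟨t, ht, h⟩ := aux_step P hPn K (S (k - 1)) hKn hNn (fun a ha => ha.1)
        (fun a ha b hb => ha.2 b hb.1) α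
        (by
          intro g
          have hd : ∀ x ∈ (P : Subgroup G),
              (α g * g⁻¹) * x * (α g * g⁻¹)⁻¹ * x⁻¹ ∈ S (k - 1) := by
            intro x hx
            have hy := hPn.conj_mem x hx g⁻¹
            have e1 := hNn.conj_mem _ (inv_mem (hα _ hy)) (α g)
            have e2 := hα x hx
            have e3 := mul_mem e1 e2
            convert e3 using 1
            simp only [map_mul, map_inv]
            group
          exact ⟨aux_burnside P hPn hcent _ hNn hfrat _ hd, hd⟩) hα
      exact ⟨t, ht.1, h⟩
    | succ j ih =>
      intro hj
      obtain ⟨s, hs, hs'⟩ := ih (by omega)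
      obtain ⟨i, hi⟩ : ∃ i, k - 1 - j = i := ⟨_, rfl⟩
      have hi' : k - 1 - (j + 1) = i - 1 := by omega
      have hi1 : 1 ≤ i := by omega
      have hi2 : i ≤ k - 1 := by omega
      rw [hi] at hs'
      rw [hi']
      let β : MulAut G := MulAut.conj s * α
      have hβ : ∀ g, β g = s * α g * s⁻¹ := fun g => rfl
      have hβ' : ∀ g, β g * g⁻¹ ∈ S i := hs'
      clear_value β
      have hNn := hnorm (i - 1) (by omega)
      have hKn := hnorm i (by omega)
      have hc : ∀ x ∈ (P : Subgroup G), ∀ y ∈ S i, x * y * x⁻¹ * y⁻¹ ∈ S (i - 1) := by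
        intro x hx y hy
        exact hcomm i hi1 hi2 (Subgroup.commutator_mem_commutator hx hy)
      have hc' : ∀ x ∈ (P : Subgroup G), ∀ y ∈ S i, y * x * y⁻¹ * x⁻¹ ∈ S (i - 1) := by
        intro x hx y hy
        have := inv_mem (hc x hx y hy)
        convert this using 1; group
      have hβP : ∀ x ∈ (P : Subgroup G), β x * x⁻¹ ∈ S (i - 1) := by
        have hh := hhom i hi1 hi2
        letI inst : ((S (i - 1)).subgroupOf (S i)).Normal :=
          Subgroup.Normal.subgroupOf (hnorm (i - 1) (by omega)) (S i)
        have hmk : ∀ a b : S i, ((a : (S i) ⧸ (S (i - 1)).subgroupOf (S i)) = b) ↔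
            (a : G)⁻¹ * b ∈ S (i - 1) := by
          intro a b
          rw [QuotientGroup.eq, Subgroup.mem_subgroupOf]; rfl
        let f : ↥(P : Subgroup G) →* (↥(S i) ⧸ (S (i - 1)).subgroupOf (S i)) :=
          MonoidHom.mk' (fun x => QuotientGroup.mk ⟨β x * (x : G)⁻¹, hβ' x⟩) (by
            intro x y
            rw [← QuotientGroup.mk_mul, hmk]
            change (β ((x : G) * y) * ((x : G) * y)⁻¹)⁻¹ *
              ((β x * (x : G)⁻¹) * (β y * (y : G)⁻¹)) ∈ S (i - 1)
            have e := hc x x.2 _ (inv_mem (hβ' y))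
            have e1 := hNn.conj_mem _ e 1
            convert e1 using 1
            rw [map_mul]
            group)
        have hf : ∀ x, f x = QuotientGroup.mk ⟨β x * (x : G)⁻¹, hβ' x⟩ := fun x => rfl
        have hf1 : f = 1 := by
          apply hh f
          · intro x hx
            refine aux_frat (p := p) ?_ ?_ f x hx
            · intro a b
              induction a using QuotientGroup.induction_on with
              | H a =>
              induction b using QuotientGroup.induction_on with
              | H b =>
              rw [← QuotientGroup.mk_mul, ← QuotientGroup.mk_mul, hmk]
              have := hc _ (inv_mem (hSP i (by omega) b.2)) _ (inv_mem a.2)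
              change ((a : G) * b)⁻¹ * ((b : G) * a) ∈ S (i - 1)
              convert this using 1; group
            · intro a
              induction a using QuotientGroup.induction_on with
              | H a =>
              rw [← QuotientGroup.mk_pow, QuotientGroup.eq_one_iff, Subgroup.mem_subgroupOf]
              exact hexp i hi1 hi2 _ a.2
          · intro g x y hxy
            rw [hf, hmk] at hxy
            rw [hf, hmk]
            change (β (g * (x : G) * g⁻¹) * (g * (x : G) * g⁻¹)⁻¹)⁻¹ * (g * (y : G) * g⁻¹)
              ∈ S (i - 1)
            change (β (x : G) * (x : G)⁻¹)⁻¹ * (y : G) ∈ S (i - 1) at hxy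
            obtain ⟨r, hr⟩ : ∃ r, r = g⁻¹ * β g := ⟨_, rfl⟩
            have hrS : r ∈ S i := by
              have := hKn.conj_mem _ (hβ' g) g⁻¹
              rw [hr]; convert this using 1; group
            have hgr : β g = g * r := by rw [hr]; group
            have hxP : β (x : G) ∈ (P : Subgroup G) := by
              have := mul_mem (hSP i (by omega) (hβ' x)) x.2
              simpa using this
            have e1 := hc' _ hxP r hrS
            have e2 := hNn.conj_mem _ (inv_mem e1) (g * (x : G) * (β (x : G))⁻¹)
            have e2 := hNn.conj_mem _ (inv_mem e1) (g * (x : G) * (β (x : G))⁻¹)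
            have e3 := hNn.conj_mem _ hxy g
            have e4 := mul_mem e2 e3
            convert e4 using 1
            rw [map_mul, map_mul, map_inv, hgr]
            group
        intro x hx
        have h1 : f ⟨x, hx⟩ = 1 := by rw [hf1]; rfl
        rw [hf, QuotientGroup.eq_one_iff, Subgroup.mem_subgroupOf] at h1
        exact h1
      obtain ⟨t, ht, h⟩ := aux_step P hPn (S i) (S (i - 1)) hKn hNn (hSP i (by omega))
        (fun a ha b hb => hc a (hSP i (by omega) ha) b hb) β hβ' hβP
      refine ⟨t * s, mul_mem (hSP i (by omega) ht) hs, fun g => ?_⟩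
      have := h g
      rw [hβ] at this
      convert this using 1; group
  obtain ⟨s, hs, h⟩ := main (k - 1) le_rfl
  refine ⟨s⁻¹, inv_mem hs, ?_⟩
  ext g
  have h0 := h g
  rw [Nat.sub_self, hS0, Subgroup.mem_bot, mul_inv_eq_one] at h0
  rw [MulAut.conj_apply]
  conv_rhs => rw [← h0]
  group
end
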